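/- Let f : 2^{[k]} → ℝ be submodular, normalized, and increasing, and let ψ : ℝ^k → {−1,1}^k be any function satisfying ψ(u)_i = sign(u_i) whenever u_i ≠ 0. Then the pair (L^f, ψ) is calibrated with respect to the structured binary classification loss ℓ^f(r, y) = f({i ∈ [k] : r_i ≠ y_i}) (with report space {−1,1}^k) if and only if f is modular. -/

import Mathlib

open Finset

noncomputable section

/-- The set {π(1),…,π(i)} of the first `i` elements under permutation `π`. -/
def Spi (k : ℕ) (π : Equiv.Perm (Fin k)) (i : ℕ) : Finset (Fin k) :=
  (Finset.univ.filter (fun m : Fin k => (m : ℕ) < i)).image π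

/-- The Lovász extension of a set function `f`. -/
def lovaszExt (k : ℕ) (f : Finset (Fin k) → ℝ) (x : Fin k → ℝ) : ℝ :=
  Finset.univ.sup' Finset.univ_nonempty
    (fun π : Equiv.Perm (Fin k) =>
      ∑ i : Fin k, x (π i) * (f (Spi k π ((i : ℕ) + 1)) - f (Spi k π (i : ℕ))))

/-- The Lovász hinge `L^f(u,y) = F((𝟙 - u ⊙ y)₊)`. -/
def lovaszHinge (k : ℕ) (f : Finset (Fin k) → ℝ) (u y : Fin k → ℝ) : ℝ :=
  lovaszExt k f (fun i => max (1 - u i * y i) 0)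

/-- The `±1` vector associated with a Boolean vector, indexing the outcome space `Y = {-1,1}^k`. -/
def ytov (k : ℕ) (b : Fin k → Bool) : Fin k → ℝ := fun i => if b i then 1 else -1

/-- `p` is a probability distribution on `Y = {-1,1}^k`. -/
def IsProb (k : ℕ) (p : (Fin k → ℝ) → ℝ) : Prop :=
  (∀ b : Fin k → Bool, 0 ≤ p (ytov k b)) ∧ ∑ b : Fin k → Bool, p (ytov k b) = 1

/-- Expected Lovász hinge loss `L^f(u; p)`. -/
def expLossL (k : ℕ) (f : Finset (Fin k) → ℝ) (u : Fin k → ℝ) (p : (Fin k → ℝ) → ℝ) : ℝ :=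
  ∑ b : Fin k → Bool, p (ytov k b) * lovaszHinge k f u (ytov k b)

/-- Expected structured binary classification loss `ℓ^f(r; p)`. -/
def expLossTgt (k : ℕ) (f : Finset (Fin k) → ℝ) (r : Fin k → ℝ) (p : (Fin k → ℝ) → ℝ) : ℝ :=
  ∑ b : Fin k → Bool, p (ytov k b) * f (Finset.univ.filter (fun i => r i ≠ ytov k b i))

/-- Minimizers of `ℓ^f(·; p)` over the report space `{-1,1}^k`. -/
def GammaTgt (k : ℕ) (f : Finset (Fin k) → ℝ) (p : (Fin k → ℝ) → ℝ) : Set (Fin k → ℝ) :=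
  {r | (∀ i, r i = -1 ∨ r i = 1) ∧
    ∀ r' : Fin k → ℝ, (∀ i, r' i = -1 ∨ r' i = 1) → expLossTgt k f r p ≤ expLossTgt k f r' p}

lemma Spi_zero {k : ℕ} (π : Equiv.Perm (Fin k)) : Spi k π 0 = ∅ := by
  simp [Spi]

lemma Spi_self {k : ℕ} (π : Equiv.Perm (Fin k)) : Spi k π k = univ := by
  ext j
  simp only [Spi, mem_image, mem_filter, mem_univ, true_and, iff_true]
  exact ⟨π.symm j, (π.symm j).isLt, by simp⟩

lemma Spi_succ {k : ℕ} (π : Equiv.Perm (Fin k)) (i : Fin k) :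
    Spi k π ((i : ℕ) + 1) = Spi k π (i : ℕ) ∪ {π i} := by
  ext j
  simp only [Spi, mem_image, mem_filter, mem_univ, true_and, mem_union, mem_singleton]
  constructor
  · rintro ⟨m, hm, rfl⟩
    rcases Nat.lt_succ_iff_lt_or_eq.mp hm with h | h
    · exact Or.inl ⟨m, h, rfl⟩
    · exact Or.inr (congrArg π (Fin.ext h))
  · rintro (⟨m, hm, rfl⟩ | rfl)
    · exact ⟨m, by omega, rfl⟩
    · exact ⟨i, by omega, rfl⟩

lemma disjoint_Spi_singleton {k : ℕ} (π : Equiv.Perm (Fin k)) (i : Fin k) :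
    Disjoint (Spi k π (i : ℕ)) {π i} := by
  simp only [disjoint_singleton_right, Spi, mem_image, mem_filter, mem_univ, true_and, not_exists,
    not_and]
  intro m hm h
  rw [π.injective h] at hm
  exact lt_irrefl _ hm

lemma sum_Spi_increments {k : ℕ} (f : Finset (Fin k) → ℝ) (hnorm : f ∅ = 0)
    (π : Equiv.Perm (Fin k)) :
    ∑ i : Fin k, (f (Spi k π ((i : ℕ) + 1)) - f (Spi k π (i : ℕ))) = f univ := by
  rw [Fin.sum_univ_eq_sum_range (fun i => f (Spi k π (i + 1)) - f (Spi k π i)) k,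
    Finset.sum_range_sub (fun i => f (Spi k π i)), Spi_zero, Spi_self, hnorm, sub_zero]

lemma le_lovaszExt {k : ℕ} (f : Finset (Fin k) → ℝ) (x : Fin k → ℝ) (π : Equiv.Perm (Fin k)) :
    ∑ i : Fin k, x (π i) * (f (Spi k π ((i : ℕ) + 1)) - f (Spi k π (i : ℕ)))
      ≤ lovaszExt k f x :=
  Finset.le_sup' (fun π : Equiv.Perm (Fin k) =>
      ∑ i : Fin k, x (π i) * (f (Spi k π ((i : ℕ) + 1)) - f (Spi k π (i : ℕ)))) (mem_univ π)

lemma lovaszExt_one {k : ℕ} (f : Finset (Fin k) → ℝ) (hnorm : f ∅ = 0) :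
    lovaszExt k f (fun _ => 1) = f univ := by
  simp [lovaszExt, sum_Spi_increments f hnorm]

lemma two_mul_le_lovaszExt_add {k : ℕ} (f : Finset (Fin k) → ℝ) (hnorm : f ∅ = 0)
    (hinc : ∀ S T : Finset (Fin k), Disjoint S T → f S ≤ f (S ∪ T))
    (x y : Fin k → ℝ) (hxy : ∀ i, 2 ≤ x i + y i) :
    2 * f univ ≤ lovaszExt k f x + lovaszExt k f y := by
  refine le_trans ?_ (add_le_add (le_lovaszExt f x 1) (le_lovaszExt f y 1))
  rw [← sum_Spi_increments f hnorm 1, Finset.mul_sum, ← Finset.sum_add_distrib]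
  refine Finset.sum_le_sum fun i _ => ?_
  rw [← add_mul]
  refine mul_le_mul_of_nonneg_right (hxy _) (sub_nonneg.mpr ?_)
  rw [Spi_succ]
  exact hinc _ _ (disjoint_Spi_singleton 1 i)

lemma lovaszExt_eq_of_modular {k : ℕ} (f : Finset (Fin k) → ℝ) (hnorm : f ∅ = 0)
    (hmod : ∀ S T : Finset (Fin k), f (S ∪ T) + f (S ∩ T) = f S + f T) (x : Fin k → ℝ) :
    lovaszExt k f x = ∑ i, f {i} * x i := by
  have key : ∀ π : Equiv.Perm (Fin k),
      ∑ i : Fin k, x (π i) * (f (Spi k π ((i : ℕ) + 1)) - f (Spi k π (i : ℕ)))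
        = ∑ i, f {i} * x i := by
    intro π
    rw [← Equiv.sum_comp π (fun i => f {i} * x i)]
    refine Finset.sum_congr rfl fun i _ => ?_
    have h := hmod (Spi k π i) {π i}
    rw [Finset.disjoint_iff_inter_eq_empty.mp (disjoint_Spi_singleton π i), hnorm,
      ← Spi_succ] at h
    rw [show f (Spi k π ((i : ℕ) + 1)) - f (Spi k π (i : ℕ)) = f {π i} by linarith, mul_comm]
  simp [lovaszExt, key]

lemma eq_sum_of_modular {k : ℕ} (f : Finset (Fin k) → ℝ) (hnorm : f ∅ = 0)
    (hmod : ∀ S T : Finset (Fin k), f (S ∪ T) + f (S ∩ T) = f S + f T) (S : Finset (Fin k)) :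
    f S = ∑ i ∈ S, f {i} := by
  induction S using Finset.induction_on with
  | empty => simp [hnorm]
  | insert a S ha ih =>
    have h := hmod {a} S
    rw [Finset.singleton_inter_of_notMem ha, hnorm, ← Finset.insert_eq] at h
    rw [Finset.sum_insert ha, ← ih]
    linarith

lemma modular_of_add_compl {k : ℕ} (f : Finset (Fin k) → ℝ)
    (hsub : ∀ S T : Finset (Fin k), f (S ∪ T) + f (S ∩ T) ≤ f S + f T)
    (hc : ∀ A : Finset (Fin k), f A + f Aᶜ = f univ) (S T : Finset (Fin k)) :
    f (S ∪ T) + f (S ∩ T) = f S + f T := by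
  have h := hsub Sᶜ Tᶜ
  rw [← Finset.compl_inter, ← Finset.compl_union] at h
  linarith [hsub S T, hc S, hc T, hc (S ∪ T), hc (S ∩ T)]

lemma ytov_eq_or {k : ℕ} (b : Fin k → Bool) (i : Fin k) :
    ytov k b i = -1 ∨ ytov k b i = 1 := by
  cases h : b i <;> simp [ytov, h]

lemma ytov_injective (k : ℕ) : Function.Injective (ytov k) := by
  intro b c h
  funext i
  have hi := congrFun h i
  cases hb : b i <;> cases hc : c i <;> simp [ytov, hb, hc] at hi ⊢ <;> norm_num at hi

/-- The distribution putting mass one half on each of the outcomes `b` and `c`. -/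
def halfHalf (k : ℕ) (b c : Fin k → Bool) (v : Fin k → ℝ) : ℝ :=
  (if v = ytov k b then 1 / 2 else 0) + (if v = ytov k c then 1 / 2 else 0)

lemma sum_halfHalf_mul {k : ℕ} (b c : Fin k → Bool) (g : (Fin k → Bool) → ℝ) :
    ∑ d, halfHalf k b c (ytov k d) * g d = (g b + g c) / 2 := by
  simp only [halfHalf, (ytov_injective k).eq_iff, add_mul, Finset.sum_add_distrib, ite_mul,
    zero_mul, Finset.sum_ite_eq', mem_univ, if_true]
  simp
  ring

lemma isProb_halfHalf {k : ℕ} (b c : Fin k → Bool) : IsProb k (halfHalf k b c) := by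
  refine ⟨fun d => ?_, ?_⟩
  · unfold halfHalf
    positivity
  · simpa using sum_halfHalf_mul b c (fun _ => 1)

/-- The mean of the `i`-th label under `p`. -/
def meanLabel (k : ℕ) (p : (Fin k → ℝ) → ℝ) (i : Fin k) : ℝ :=
  ∑ b : Fin k → Bool, p (ytov k b) * ytov k b i

/-- The expected binary hinge loss of the prediction `t` for the `i`-th label under `p`. -/
def expHinge (k : ℕ) (p : (Fin k → ℝ) → ℝ) (i : Fin k) (t : ℝ) : ℝ :=
  ∑ b : Fin k → Bool, p (ytov k b) * max (1 - t * ytov k b i) 0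

lemma sum_mul_one_sub {k : ℕ} {p : (Fin k → ℝ) → ℝ} (hp : IsProb k p) (i : Fin k) (s : ℝ) :
    ∑ b : Fin k → Bool, p (ytov k b) * (1 - s * ytov k b i) = 1 - s * meanLabel k p i := by
  simp only [mul_sub, Finset.sum_sub_distrib, mul_one, hp.2, meanLabel, Finset.mul_sum,
    mul_left_comm]

lemma one_sub_le_expHinge {k : ℕ} {p : (Fin k → ℝ) → ℝ} (hp : IsProb k p) (i : Fin k) (t : ℝ) :
    1 - max (-1) (min 1 t) * meanLabel k p i ≤ expHinge k p i t := by
  rw [← sum_mul_one_sub hp]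
  refine Finset.sum_le_sum fun b _ => mul_le_mul_of_nonneg_left ?_ (hp.1 b)
  rcases ytov_eq_or b i with h | h <;> rw [h] <;> grind

lemma one_sub_abs_le_expHinge {k : ℕ} {p : (Fin k → ℝ) → ℝ} (hp : IsProb k p) (i : Fin k)
    (t : ℝ) : 1 - |meanLabel k p i| ≤ expHinge k p i t := by
  refine le_trans ?_ (one_sub_le_expHinge hp i t)
  have h : |max (-1) (min 1 t)| ≤ 1 := abs_le.mpr ⟨le_max_left _ _, by simp⟩
  have h' := (le_abs_self _).trans (abs_mul (max (-1) (min 1 t)) (meanLabel k p i)).le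
  nlinarith [abs_nonneg (meanLabel k p i)]

lemma one_le_expHinge {k : ℕ} {p : (Fin k → ℝ) → ℝ} (hp : IsProb k p) (i : Fin k) {t : ℝ}
    (ht : t * meanLabel k p i ≤ 0) : 1 ≤ expHinge k p i t := by
  have h : 1 - t * meanLabel k p i ≤ expHinge k p i t := by
    rw [← sum_mul_one_sub hp]
    exact Finset.sum_le_sum fun b _ => mul_le_mul_of_nonneg_left (le_max_left _ _) (hp.1 b)
  linarith

lemma expHinge_signed {k : ℕ} {p : (Fin k → ℝ) → ℝ} (hp : IsProb k p) (i : Fin k) :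
    expHinge k p i (if 0 ≤ meanLabel k p i then 1 else -1) = 1 - |meanLabel k p i| := by
  have h : ∀ s : ℝ, s = -1 ∨ s = 1 → expHinge k p i s = 1 - s * meanLabel k p i := by
    intro s hs
    rw [← sum_mul_one_sub hp]
    refine Finset.sum_congr rfl fun b _ => ?_
    rw [max_eq_left]
    rcases hs with rfl | rfl <;> rcases ytov_eq_or b i with h | h <;> rw [h] <;> norm_num
  split_ifs with hm
  · rw [h 1 (Or.inr rfl), abs_of_nonneg hm, one_mul]
  · rw [h (-1) (Or.inl rfl), abs_of_neg (not_le.mp hm), neg_one_mul]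

lemma expLossL_eq_of_modular {k : ℕ} (f : Finset (Fin k) → ℝ) (hnorm : f ∅ = 0)
    (hmod : ∀ S T : Finset (Fin k), f (S ∪ T) + f (S ∩ T) = f S + f T)
    (u : Fin k → ℝ) (p : (Fin k → ℝ) → ℝ) :
    expLossL k f u p = ∑ i, f {i} * expHinge k p i (u i) := by
  simp only [expLossL, lovaszHinge, lovaszExt_eq_of_modular f hnorm hmod, expHinge,
    Finset.mul_sum]
  rw [Finset.sum_comm]
  exact Finset.sum_congr rfl fun i _ => Finset.sum_congr rfl fun b _ => by ring

lemma expLossTgt_eq_of_modular {k : ℕ} (f : Finset (Fin k) → ℝ) (hnorm : f ∅ = 0)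
    (hmod : ∀ S T : Finset (Fin k), f (S ∪ T) + f (S ∩ T) = f S + f T)
    (r : Fin k → ℝ) (hr : ∀ i, r i = -1 ∨ r i = 1) {p : (Fin k → ℝ) → ℝ} (hp : IsProb k p) :
    expLossTgt k f r p = ∑ i, f {i} * ((1 - r i * meanLabel k p i) / 2) := by
  have h : ∀ b : Fin k → Bool, f (univ.filter (fun i => r i ≠ ytov k b i))
      = ∑ i, f {i} * ((1 - r i * ytov k b i) / 2) := by
    intro b
    rw [eq_sum_of_modular f hnorm hmod, Finset.sum_filter]
    refine Finset.sum_congr rfl fun i _ => ?_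
    rcases hr i with h | h <;> rcases ytov_eq_or b i with h' | h' <;> rw [h, h'] <;> norm_num
  simp only [expLossTgt, h, Finset.mul_sum, ← sum_mul_one_sub hp, Finset.sum_div]
  rw [Finset.sum_comm]
  exact Finset.sum_congr rfl fun i _ => Finset.sum_congr rfl fun b _ => by ring

lemma exists_pos_le_of_pos {ι : Type*} [Finite ι] [Nonempty ι] (g : ι → ℝ) :
    ∃ δ : ℝ, 0 < δ ∧ ∀ i, 0 < g i → δ ≤ g i := by
  obtain ⟨i₀, h₀⟩ := Finite.exists_min (fun i => if 0 < g i then g i else 1)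
  refine ⟨if 0 < g i₀ then g i₀ else 1, by split_ifs <;> linarith, fun i hi => ?_⟩
  simpa [hi] using h₀ i

/-- The separable hinge loss of a modular `f` is calibrated. -/
lemma calibrated_of_modular {k : ℕ} (hk : 1 ≤ k) (f : Finset (Fin k) → ℝ)
    (hinc : ∀ S T : Finset (Fin k), Disjoint S T → f S ≤ f (S ∪ T))
    (hnorm : f ∅ = 0)
    (hmod : ∀ S T : Finset (Fin k), f (S ∪ T) + f (S ∩ T) = f S + f T)
    (ψ : (Fin k → ℝ) → (Fin k → ℝ))
    (hψY : ∀ u : Fin k → ℝ, ∀ i, ψ u i = -1 ∨ ψ u i = 1)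
    (hψ : ∀ (u : Fin k → ℝ) (i : Fin k), u i ≠ 0 → ψ u i = Real.sign (u i))
    (p : (Fin k → ℝ) → ℝ) (hp : IsProb k p) :
    ∃ c : ℝ, (∀ u : Fin k → ℝ, ψ u ∉ GammaTgt k f p → c ≤ expLossL k f u p) ∧
      ∃ u₀ : Fin k → ℝ, expLossL k f u₀ p < c := by
  have : Nonempty (Fin k) := ⟨⟨0, hk⟩⟩
  have hw : ∀ i, 0 ≤ f {i} := fun i => by simpa [hnorm] using hinc ∅ {i} (by simp)
  set m := meanLabel k p with hm
  obtain ⟨δ, hδ, hδle⟩ := exists_pos_le_of_pos (fun i => f {i} * |m i|)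
  refine ⟨∑ i, f {i} * (1 - |m i|) + δ, fun u hu => ?_,
    fun i => if 0 ≤ m i then 1 else -1, ?_⟩
  · obtain ⟨r, hr, hlt⟩ : ∃ r : Fin k → ℝ, (∀ i, r i = -1 ∨ r i = 1) ∧
        expLossTgt k f r p < expLossTgt k f (ψ u) p := by
      by_contra! h
      exact hu ⟨hψY u, h⟩
    rw [expLossTgt_eq_of_modular f hnorm hmod r hr hp,
      expLossTgt_eq_of_modular f hnorm hmod _ (hψY u) hp] at hlt
    obtain ⟨i, -, hi⟩ := Finset.exists_lt_of_sum_lt hlt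
    rw [← hm] at hi
    have hwi : 0 < f {i} := (hw i).lt_of_ne fun h => by simp [← h] at hi
    have hrm : ψ u i * m i < r i * m i := by
      have := lt_of_mul_lt_mul_left hi (hw i)
      linarith
    have hψm : ψ u i * m i < 0 := by
      rcases hr i with h | h <;> rcases hψY u i with h' | h' <;> rw [h, h'] at hrm <;> rw [h'] <;>
        linarith
    have hm0 : m i ≠ 0 := fun h => by simp [h] at hψm
    have hum : u i * m i ≤ 0 := by
      rcases lt_trichotomy (u i) 0 with h | h | h
      · rw [hψ u i h.ne, Real.sign_of_neg h] at hψm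
        nlinarith
      · simp [h]
      · rw [hψ u i h.ne', Real.sign_of_pos h] at hψm
        nlinarith
    have hδi := hδle i (mul_pos hwi (abs_pos.mpr hm0))
    have h1 := mul_le_mul_of_nonneg_left (one_le_expHinge hp i hum) hwi.le
    rw [expLossL_eq_of_modular f hnorm hmod, ← Finset.add_sum_erase univ _ (mem_univ i),
      ← Finset.add_sum_erase univ (fun i => f {i} * expHinge k p i (u i)) (mem_univ i)]
    have h2 : ∑ j ∈ univ.erase i, f {j} * (1 - |m j|)
        ≤ ∑ j ∈ univ.erase i, f {j} * expHinge k p j (u j) :=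
      Finset.sum_le_sum fun j _ =>
        mul_le_mul_of_nonneg_left (one_sub_abs_le_expHinge hp j (u j)) (hw j)
    linarith
  · rw [expLossL_eq_of_modular f hnorm hmod]
    simp only [hm, expHinge_signed hp]
    linarith

/-- Under the uniform distribution on two opposite outcomes, `0` minimizes the expected
Lovász hinge. -/
lemma expLossL_halfHalf_zero_le {k : ℕ} (f : Finset (Fin k) → ℝ)
    (hinc : ∀ S T : Finset (Fin k), Disjoint S T → f S ≤ f (S ∪ T))
    (hnorm : f ∅ = 0) (b : Fin k → Bool) (u : Fin k → ℝ) :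
    expLossL k f 0 (halfHalf k b (fun i => !b i))
      ≤ expLossL k f u (halfHalf k b (fun i => !b i)) := by
  rw [expLossL, expLossL, sum_halfHalf_mul b _ (fun d => lovaszHinge k f 0 (ytov k d)),
    sum_halfHalf_mul b _ (fun d => lovaszHinge k f u (ytov k d))]
  have h0 : ∀ y, lovaszHinge k f 0 y = f univ := fun y => by
    simp [lovaszHinge, lovaszExt_one f hnorm]
  have h := two_mul_le_lovaszExt_add f hnorm hinc
    (fun i => max (1 - u i * ytov k b i) 0)
    (fun i => max (1 - u i * ytov k (fun i => !b i) i) 0) (fun i => by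
      have hneg : ytov k (fun i => !b i) i = -ytov k b i := by cases h : b i <;> simp [ytov, h]
      rw [hneg]
      linarith [le_max_left (1 - u i * ytov k b i) 0, le_max_left (1 - u i * -ytov k b i) 0])
  simp only [h0]
  unfold lovaszHinge
  linarith

/-- Calibration at all uniform distributions on two opposite outcomes makes `f` additive on
complementary pairs. -/
lemma compl_additive_of_calibrated {k : ℕ} (f : Finset (Fin k) → ℝ)
    (hsub : ∀ S T : Finset (Fin k), f (S ∪ T) + f (S ∩ T) ≤ f S + f T)
    (hinc : ∀ S T : Finset (Fin k), Disjoint S T → f S ≤ f (S ∪ T))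
    (hnorm : f ∅ = 0)
    (ψ : (Fin k → ℝ) → (Fin k → ℝ))
    (hψY : ∀ u : Fin k → ℝ, ∀ i, ψ u i = -1 ∨ ψ u i = 1)
    (hcal : ∀ p : (Fin k → ℝ) → ℝ, IsProb k p →
        ∃ c : ℝ, (∀ u : Fin k → ℝ, ψ u ∉ GammaTgt k f p → c ≤ expLossL k f u p) ∧
          ∃ u₀ : Fin k → ℝ, expLossL k f u₀ p < c)
    (A : Finset (Fin k)) : f A + f Aᶜ = f univ := by
  classical
  set r := ψ 0 with hr
  set b : Fin k → Bool := fun i => decide (r i = 1 ↔ i ∉ A) with hb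
  have hA : univ.filter (fun i => r i ≠ ytov k b i) = A := by
    ext i
    rcases hψY 0 i with h | h <;> rw [← hr] at h <;> by_cases hi : i ∈ A <;>
      simp [ytov, hb, h, hi] <;> norm_num
  have hAc : univ.filter (fun i => r i ≠ ytov k (fun i => !b i) i) = Aᶜ := by
    ext i
    rcases hψY 0 i with h | h <;> rw [← hr] at h <;> by_cases hi : i ∈ A <;>
      simp [ytov, hb, h, hi] <;> norm_num
  have hU : univ.filter (fun i => ytov k b i ≠ ytov k (fun i => !b i) i) = univ := by
    ext i
    cases h : b i <;> simp [ytov, h] <;> norm_num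
  have hmem : r ∈ GammaTgt k f (halfHalf k b (fun i => !b i)) := by
    obtain ⟨c, hc, u₀, hu₀⟩ := hcal _ (isProb_halfHalf b (fun i => !b i))
    by_contra hn
    linarith [hc 0 hn, expLossL_halfHalf_zero_le f hinc hnorm b u₀]
  have hle := hmem.2 (ytov k b) (ytov_eq_or b)
  rw [expLossTgt, expLossTgt,
    sum_halfHalf_mul b _ (fun d => f (univ.filter (fun i => r i ≠ ytov k d i))),
    sum_halfHalf_mul b _ (fun d => f (univ.filter (fun i => ytov k b i ≠ ytov k d i))),
    hA, hAc, hU] at hle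
  have hge := hsub A Aᶜ
  simp only [Finset.union_compl, Finset.inter_compl, ne_eq, not_true_eq_false,
    Finset.filter_false, hnorm] at hle hge
  linarith

/-- `(L^f, sign)` is calibrated for structured binary classification iff
`f` is modular. -/
theorem stmt10 (k : ℕ) (hk : 1 ≤ k) (f : Finset (Fin k) → ℝ)
    (hsub : ∀ S T : Finset (Fin k), f (S ∪ T) + f (S ∩ T) ≤ f S + f T)
    (hinc : ∀ S T : Finset (Fin k), Disjoint S T → f S ≤ f (S ∪ T))
    (hnorm : f ∅ = 0)
    (ψ : (Fin k → ℝ) → (Fin k → ℝ))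
    (hψY : ∀ u : Fin k → ℝ, ∀ i, ψ u i = -1 ∨ ψ u i = 1)
    (hψ : ∀ (u : Fin k → ℝ) (i : Fin k), u i ≠ 0 → ψ u i = Real.sign (u i)) :
    (∀ p : (Fin k → ℝ) → ℝ, IsProb k p →
        ∃ c : ℝ, (∀ u : Fin k → ℝ, ψ u ∉ GammaTgt k f p → c ≤ expLossL k f u p) ∧
          ∃ u₀ : Fin k → ℝ, expLossL k f u₀ p < c)
      ↔ (∀ S T : Finset (Fin k), f (S ∪ T) + f (S ∩ T) = f S + f T) := by
  exact ⟨fun hcal => modular_of_add_compl f hsub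
      (compl_additive_of_calibrated f hsub hinc hnorm ψ hψY hcal),
    fun hmod p hp => calibrated_of_modular hk f hinc hnorm hmod ψ hψY hψ p hp⟩
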